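/- Suppose j ≥ 3 and α = α_1⋯α_j and β = β_1⋯β_j are mutually minimal overlapping permutations in S_j, and there is an a with 1 ≤ a < j such that α_i = β_i for all i ≤ a, α_a = β_a = 1, α_j = β_j, des(α) = des(β), and inv(α) = inv(β). Then for all n ≥ 0, Σ_{σ∈NM_n(α)} x^{des(σ)} y^{LRmin(σ)} q^{inv(σ)} = Σ_{σ∈NM_n(β)} x^{des(σ)} y^{LRmin(σ)} q^{inv(σ)}, as polynomials in x, y and q; that is, α and β are (des,inv,LRmin)-c-Wilf equivalent. -/

import Mathlib

open scoped Classical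

noncomputable section

namespace CWilf

/-- The number of descents of a permutation of `{0, …, n-1}` (0-based). -/
def des {n : ℕ} (σ : Equiv.Perm (Fin n)) : ℕ :=
  (Finset.univ.filter fun i : Fin n =>
    ∃ h : (i : ℕ) + 1 < n, σ ⟨(i : ℕ) + 1, h⟩ < σ i).card

/-- The number of inversions of `σ`. -/
def inv {n : ℕ} (σ : Equiv.Perm (Fin n)) : ℕ :=
  (Finset.univ.filter fun q : Fin n × Fin n => q.1 < q.2 ∧ σ q.2 < σ q.1).card

/-- The number of coinversions of `σ`. -/
def coinv {n : ℕ} (σ : Equiv.Perm (Fin n)) : ℕ :=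
  (Finset.univ.filter fun q : Fin n × Fin n => q.1 < q.2 ∧ σ q.1 < σ q.2).card

/-- The number of left-to-right minima of `σ`. -/
def LRmin {n : ℕ} (σ : Equiv.Perm (Fin n)) : ℕ :=
  (Finset.univ.filter fun j : Fin n => ∀ i : Fin n, i < j → σ j < σ i).card

/-- There is a `τ`-match of `σ` starting at (0-based) position `i`, i.e.
`red(σ_i σ_{i+1} ⋯ σ_{i+j-1}) = τ`. -/
def MatchAt {j n : ℕ} (τ : Equiv.Perm (Fin j)) (σ : Equiv.Perm (Fin n)) (i : ℕ) : Prop :=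
  ∃ h : i + j ≤ n, ∀ a b : Fin j,
    τ a < τ b ↔
      σ ⟨i + (a : ℕ), by have := a.isLt; omega⟩ < σ ⟨i + (b : ℕ), by have := b.isLt; omega⟩

/-- The number of `τ`-matches of `σ`. -/
def mch {j n : ℕ} (τ : Equiv.Perm (Fin j)) (σ : Equiv.Perm (Fin n)) : ℕ :=
  ((Finset.range n).filter fun i => MatchAt τ σ i).card

/-- `τ` is minimal overlapping: the smallest `n` such that some `σ ∈ S_n` has
exactly two `τ`-matches is `2j - 1`. -/
def MinOverlapping {j : ℕ} (τ : Equiv.Perm (Fin j)) : Prop :=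
  IsLeast {n : ℕ | ∃ σ : Equiv.Perm (Fin n), mch τ σ = 2} (2 * j - 1)

/-- `α` and `β` are mutually minimal overlapping. -/
def MutuallyMinOverlapping {j : ℕ} (α β : Equiv.Perm (Fin j)) : Prop :=
  MinOverlapping α ∧ MinOverlapping β ∧
    IsLeast {n : ℕ | ∃ σ : Equiv.Perm (Fin n), 1 ≤ mch α σ ∧ 1 ≤ mch β σ} (2 * j - 1)

/-- The set of permutations of `S_n` with no `τ`-match. -/
def NM (n : ℕ) {j : ℕ} (τ : Equiv.Perm (Fin j)) : Finset (Equiv.Perm (Fin n)) :=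
  Finset.univ.filter fun σ => mch τ σ = 0

section

variable {j n : ℕ}

/-- The embedding of positions `0, …, j-1` as the window `i, …, i+j-1`. -/
def window (i : ℕ) (h : i + j ≤ n) : Fin j ↪ Fin n where
  toFun k := ⟨i + (k : ℕ), by have := k.isLt; omega⟩
  inj' a b hab := by
    have := congrArg Fin.val hab
    exact Fin.ext (by simpa using this)

@[simp] lemma window_val (i : ℕ) (h : i + j ≤ n) (k : Fin j) :
    (window i h k : ℕ) = i + k := rfl

lemma window_lt_window {i : ℕ} (h : i + j ≤ n) (k l : Fin j) :
    window i h k < window i h l ↔ k < l := by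
  rw [Fin.lt_def, Fin.lt_def, window_val, window_val, Nat.add_lt_add_iff_left]

lemma mem_range_window {i : ℕ} (h : i + j ≤ n) (x : Fin n) :
    x ∈ Set.range (window i h) ↔ i ≤ x ∧ (x : ℕ) < i + j := by
  constructor
  · rintro ⟨k, rfl⟩
    have := k.isLt
    simp
  · rintro ⟨h1, h2⟩
    exact ⟨⟨x - i, by omega⟩, Fin.ext (by simp; omega)⟩

lemma matchAt_iff {τ : Equiv.Perm (Fin j)} {σ : Equiv.Perm (Fin n)} {i : ℕ} (h : i + j ≤ n) :
    MatchAt τ σ i ↔ ∀ a b, τ a < τ b ↔ σ (window i h a) < σ (window i h b) :=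
  ⟨fun ⟨_, H⟩ => H, fun H => ⟨h, H⟩⟩

/-- The permutation of positions replacing an `α`-match at `i` by a `β`-match. -/
def swapAt (α β : Equiv.Perm (Fin j)) (i : ℕ) (h : i + j ≤ n) : Equiv.Perm (Fin n) :=
  (α⁻¹ * β).viaEmbedding (window i h)

lemma swapAt_window (α β : Equiv.Perm (Fin j)) (i : ℕ) (h : i + j ≤ n) (k : Fin j) :
    swapAt α β i h (window i h k) = window i h (α⁻¹ (β k)) :=
  Equiv.Perm.viaEmbedding_apply _ _ _

lemma swapAt_of_notMem (α β : Equiv.Perm (Fin j)) {i : ℕ} (h : i + j ≤ n) {x : Fin n}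
    (hx : ¬ (i ≤ (x : ℕ) ∧ (x : ℕ) < i + j)) : swapAt α β i h x = x :=
  Equiv.Perm.viaEmbedding_apply_of_notMem _ _ _ (by rwa [mem_range_window])

lemma swapAt_mem_iff (α β : Equiv.Perm (Fin j)) {i : ℕ} (h : i + j ≤ n) (x : Fin n) :
    (i ≤ (swapAt α β i h x : ℕ) ∧ (swapAt α β i h x : ℕ) < i + j) ↔
      (i ≤ (x : ℕ) ∧ (x : ℕ) < i + j) := by
  by_cases hx : i ≤ (x : ℕ) ∧ (x : ℕ) < i + j
  · obtain ⟨k, rfl⟩ := (mem_range_window h x).2 hx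
    rw [swapAt_window]
    simp
  · rw [swapAt_of_notMem α β h hx]

lemma swapAt_of_eq {α β : Equiv.Perm (Fin j)} {i : ℕ} (h : i + j ≤ n) {k : Fin j}
    (hk : α k = β k) : swapAt α β i h (window i h k) = window i h k := by
  simp [swapAt_window, ← hk]

lemma matchAt_mul_swapAt (α β : Equiv.Perm (Fin j)) (σ : Equiv.Perm (Fin n)) {i : ℕ}
    (h : i + j ≤ n) : MatchAt β (σ * swapAt α β i h) i ↔ MatchAt α σ i := by
  simp only [matchAt_iff h, Equiv.Perm.mul_apply, swapAt_window]
  constructor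
  · intro H a b
    simpa using H (β⁻¹ (α a)) (β⁻¹ (α b))
  · intro H a b
    simpa using H (α⁻¹ (β a)) (α⁻¹ (β b))

/-- Replacing a match leaves alone the positions outside the interior of the window. -/
lemma swapAt_of_outer {α β : Equiv.Perm (Fin j)}
    (hends : ∀ k : Fin j, (k : ℕ) = 0 ∨ (k : ℕ) = j - 1 → α k = β k) {i : ℕ} (h : i + j ≤ n)
    {x : Fin n} (hx : (x : ℕ) ≤ i ∨ i + (j - 1) ≤ x) : swapAt α β i h x = x := by
  by_cases hw : i ≤ (x : ℕ) ∧ (x : ℕ) < i + j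
  · obtain ⟨k, rfl⟩ := (mem_range_window h x).2 hw
    have := k.isLt
    rw [window_val] at hx
    exact swapAt_of_eq h (hends k (by omega))
  · exact swapAt_of_notMem α β h hw

lemma matchAt_mul_swapAt_of_far {α β : Equiv.Perm (Fin j)}
    (hends : ∀ k : Fin j, (k : ℕ) = 0 ∨ (k : ℕ) = j - 1 → α k = β k)
    (τ : Equiv.Perm (Fin j)) (σ : Equiv.Perm (Fin n)) {i s : ℕ} (h : i + j ≤ n)
    (hs : s + (j - 1) ≤ i ∨ i + (j - 1) ≤ s) :
    MatchAt τ (σ * swapAt α β i h) s ↔ MatchAt τ σ s := by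
  by_cases hsn : s + j ≤ n
  · have key : ∀ k, swapAt α β i h (window s hsn k) = window s hsn k := fun k => by
      apply swapAt_of_outer hends h
      have := k.isLt
      rw [window_val]
      omega
    simp only [matchAt_iff hsn, Equiv.Perm.mul_apply, key]
  · exact ⟨fun ⟨H, _⟩ => absurd H hsn, fun ⟨H, _⟩ => absurd H hsn⟩

/-- The descents inside the window of a `τ`-match are counted by `des τ`. -/
lemma des_eq_add {τ : Equiv.Perm (Fin j)} {σ : Equiv.Perm (Fin n)} {i : ℕ} (h : i + j ≤ n)
    (hm : MatchAt τ σ i) :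
    des σ = des τ + ((Finset.univ.filter fun x : Fin n =>
      ∃ h : (x : ℕ) + 1 < n, σ ⟨(x : ℕ) + 1, h⟩ < σ x).filter
        fun x : Fin n => ¬ (i ≤ (x : ℕ) ∧ (x : ℕ) + 1 < i + j)).card := by
  rw [matchAt_iff h] at hm
  rw [des, ← Finset.card_filter_add_card_filter_not
    (fun x : Fin n => i ≤ (x : ℕ) ∧ (x : ℕ) + 1 < i + j)]
  congr 1
  rw [des, ← Finset.card_map (window i h)]
  congr 1
  ext x
  simp only [Finset.mem_filter, Finset.mem_univ, true_and, Finset.mem_map]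
  constructor
  · rintro ⟨⟨h1, hlt⟩, h2, h3⟩
    refine ⟨⟨x - i, by omega⟩, ⟨by simp; omega, ?_⟩, Fin.ext (by simp; omega)⟩
    rw [hm]
    convert hlt using 2 <;> apply Fin.ext <;> simp <;> omega
  · rintro ⟨k, ⟨h1, hlt⟩, rfl⟩
    rw [hm] at hlt
    refine ⟨⟨by simp; omega, hlt⟩, by simp, by simp; omega⟩

lemma des_mul_swapAt {α β : Equiv.Perm (Fin j)}
    (hends : ∀ k : Fin j, (k : ℕ) = 0 ∨ (k : ℕ) = j - 1 → α k = β k) (hdes : des α = des β)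
    {σ : Equiv.Perm (Fin n)} {i : ℕ} (h : i + j ≤ n) (hm : MatchAt α σ i) :
    des (σ * swapAt α β i h) = des σ := by
  rw [des_eq_add h hm, des_eq_add h ((matchAt_mul_swapAt α β σ h).2 hm), hdes,
    Finset.filter_filter, Finset.filter_filter]
  congr 2
  ext x
  rw [Finset.mem_filter, Finset.mem_filter]
  simp only [Finset.mem_univ, true_and, Equiv.Perm.mul_apply]
  refine and_congr_left fun hx => exists_congr fun hx1 => ?_
  rw [swapAt_of_outer hends h (x := x) (by omega),
    swapAt_of_outer hends h (x := ⟨x + 1, hx1⟩) (by simp only; omega)]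

/-- The inversions inside the window of a `τ`-match are counted by `inv τ`. -/
lemma inv_eq_add {τ : Equiv.Perm (Fin j)} {σ : Equiv.Perm (Fin n)} {i : ℕ} (h : i + j ≤ n)
    (hm : MatchAt τ σ i) :
    inv σ = inv τ + ((Finset.univ.filter fun q : Fin n × Fin n =>
      q.1 < q.2 ∧ σ q.2 < σ q.1).filter fun q : Fin n × Fin n =>
        ¬ (q.1 ∈ Set.range (window i h) ∧ q.2 ∈ Set.range (window i h))).card := by
  rw [matchAt_iff h] at hm
  rw [inv, ← Finset.card_filter_add_card_filter_not
    (fun q : Fin n × Fin n => q.1 ∈ Set.range (window i h) ∧ q.2 ∈ Set.range (window i h))]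
  congr 1
  rw [inv, ← Finset.card_map ((window i h).prodMap (window i h))]
  congr 1
  ext ⟨x, y⟩
  simp only [Finset.mem_filter, Finset.mem_univ, true_and, Finset.mem_map]
  constructor
  · rintro ⟨⟨h1, h2⟩, ⟨k, rfl⟩, ⟨l, rfl⟩⟩
    exact ⟨(k, l), ⟨(window_lt_window h k l).1 h1, (hm l k).2 h2⟩, rfl⟩
  · rintro ⟨⟨k, l⟩, ⟨h1, h2⟩, he⟩
    obtain ⟨rfl, rfl⟩ := Prod.ext_iff.1 he
    exact ⟨⟨(window_lt_window h k l).2 h1, (hm l k).1 h2⟩, ⟨k, rfl⟩, ⟨l, rfl⟩⟩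

lemma swapAt_lt_swapAt (α β : Equiv.Perm (Fin j)) {i : ℕ} (h : i + j ≤ n) {x y : Fin n}
    (hxy : ¬ (x ∈ Set.range (window i h) ∧ y ∈ Set.range (window i h))) :
    swapAt α β i h x < swapAt α β i h y ↔ x < y := by
  simp only [mem_range_window] at hxy
  have hx := swapAt_mem_iff α β h x
  have hy := swapAt_mem_iff α β h y
  simp only [Fin.lt_def]
  by_cases h1 : i ≤ (x : ℕ) ∧ (x : ℕ) < i + j
  · rw [swapAt_of_notMem α β h (x := y) (fun h2 => hxy ⟨h1, h2⟩)]
    omega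
  · rw [swapAt_of_notMem α β h h1]
    by_cases h2 : i ≤ (y : ℕ) ∧ (y : ℕ) < i + j
    · omega
    · rw [swapAt_of_notMem α β h h2]

lemma inv_mul_swapAt {α β : Equiv.Perm (Fin j)} (hinv : inv α = inv β)
    {σ : Equiv.Perm (Fin n)} {i : ℕ} (h : i + j ≤ n) (hm : MatchAt α σ i) :
    inv (σ * swapAt α β i h) = inv σ := by
  rw [inv_eq_add h hm, inv_eq_add h ((matchAt_mul_swapAt α β σ h).2 hm), hinv,
    Finset.filter_filter, Finset.filter_filter]
  congr 1
  refine Finset.card_equiv ((swapAt α β i h).prodCongr (swapAt α β i h)) ?_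
  rintro ⟨x, y⟩
  rw [Finset.mem_filter, Finset.mem_filter]
  simp only [Finset.mem_univ, true_and, Equiv.Perm.mul_apply,
    Equiv.prodCongr_apply, Prod.map]
  have hr : ∀ z, swapAt α β i h z ∈ Set.range (window i h) ↔ z ∈ Set.range (window i h) :=
    fun z => by rw [mem_range_window, mem_range_window, swapAt_mem_iff]
  rw [hr, hr]
  exact and_congr_left fun hxy => by rw [swapAt_lt_swapAt α β h hxy]

lemma LRmin_mul_swapAt {α β : Equiv.Perm (Fin j)} {p : Fin j}
    (hpre : ∀ k ≤ p, α k = β k) (hmin : ∀ k, α p ≤ α k)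
    {σ : Equiv.Perm (Fin n)} {i : ℕ} (h : i + j ≤ n) (hm : MatchAt α σ i) :
    LRmin (σ * swapAt α β i h) = LRmin σ := by
  have hm' := (matchAt_mul_swapAt α β σ h).2 hm
  have hmin' : ∀ k, β p ≤ β k := fun k => by
    simpa [hpre p le_rfl] using hmin (α⁻¹ (β k))
  rw [matchAt_iff h] at hm hm'
  have hfix : ∀ y : Fin n, (y : ℕ) ≤ i + p → swapAt α β i h y = y := fun y hy => by
    by_cases hy' : i ≤ (y : ℕ) ∧ (y : ℕ) < i + j
    · obtain ⟨k, rfl⟩ := (mem_range_window h y).2 hy'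
      rw [window_val] at hy
      exact swapAt_of_eq h (hpre k (by rw [Fin.le_def]; omega))
    · exact swapAt_of_notMem α β h hy'
  rw [LRmin, LRmin]
  congr 1
  ext x
  simp only [Finset.mem_filter, Finset.mem_univ, true_and]
  by_cases hx : (x : ℕ) ≤ i + p
  · refine forall_congr' fun y => imp_congr_right fun hy => ?_
    have : (y : ℕ) < x := hy
    rw [Equiv.Perm.mul_apply, Equiv.Perm.mul_apply, hfix x hx, hfix y (by omega)]
  by_cases hx' : (x : ℕ) < i + j
  · obtain ⟨k, rfl⟩ := (mem_range_window h x).2 ⟨by omega, hx'⟩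
    rw [window_val] at hx
    have hlt : p < k := by
      rw [Fin.lt_def]
      omega
    have hw := (window_lt_window h _ _).2 hlt
    exact iff_of_false
      (fun H => lt_asymm (H _ hw)
        ((hm' _ _).1 (lt_of_le_of_ne (hmin' k) (β.injective.ne hlt.ne))))
      (fun H => lt_asymm (H _ hw)
        ((hm _ _).1 (lt_of_le_of_ne (hmin k) (α.injective.ne hlt.ne))))
  · have hxf : swapAt α β i h x = x := swapAt_of_notMem α β h (by omega)
    have hlt : ∀ y, swapAt α β i h y < x ↔ y < x := fun y => by
      conv_lhs => rw [← hxf]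
      refine swapAt_lt_swapAt α β h fun hc => ?_
      have := (mem_range_window h x).1 hc.2
      omega
    simp only [Equiv.Perm.mul_apply, hxf]
    constructor
    · intro H y hy
      have := H ((swapAt α β i h)⁻¹ y) (by rw [← hlt]; simpa using hy)
      simpa using this
    · intro H y hy
      exact H _ ((hlt y).2 hy)

/-- The standardization of an injective word. -/
lemma exists_perm_lt_iff {m : ℕ} {f : Fin m → Fin n} (hf : Function.Injective f) :
    ∃ τ : Equiv.Perm (Fin m), ∀ a b, τ a < τ b ↔ f a < f b := by
  refine ⟨(Tuple.sort f)⁻¹, fun a b => ?_⟩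
  have hmono : StrictMono (f ∘ Tuple.sort f) :=
    (Tuple.monotone_sort f).strictMono_of_injective (hf.comp (Tuple.sort f).injective)
  simpa using (hmono.lt_iff_lt (a := (Tuple.sort f)⁻¹ a) (b := (Tuple.sort f)⁻¹ b)).symm

/-- Two matches of a minimal overlapping permutation share at most one position. -/
lemma MinOverlapping.le_of_matchAt {τ : Equiv.Perm (Fin j)} (hj : 0 < j)
    (hτ : MinOverlapping τ) {σ : Equiv.Perm (Fin n)} {s t : ℕ} (hst : s < t)
    (hs : MatchAt τ σ s) (ht : MatchAt τ σ t) : s + (j - 1) ≤ t := by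
  have hex : ∃ u, s < u ∧ MatchAt τ σ u := ⟨t, hst, ht⟩
  obtain ⟨hsu, hu⟩ := Nat.find_spec hex
  have hmin : ∀ v, s < v → MatchAt τ σ v → Nat.find hex ≤ v :=
    fun v h1 h2 => Nat.find_min' hex ⟨h1, h2⟩
  have hut := hmin t hst ht
  generalize Nat.find hex = u at hsu hu hmin hut
  have hun : s + (u - s + j) ≤ n := by obtain ⟨h, -⟩ := hu; omega
  obtain ⟨ρ, hρ⟩ := exists_perm_lt_iff
    (σ.injective.comp (window s hun).injective)
  have hmatch : ∀ v, v ≤ u - s → (MatchAt τ ρ v ↔ MatchAt τ σ (s + v)) := fun v hv => by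
    rw [matchAt_iff (show v + j ≤ u - s + j by omega),
      matchAt_iff (show s + v + j ≤ n by omega)]
    have key : ∀ k : Fin j, window s hun (window v (by omega) k) =
        window (s + v) (by omega) k := fun k => Fin.ext (by simp [add_assoc])
    simp only [hρ, Function.comp_apply, key]
  have hcard : mch τ ρ = 2 := by
    rw [mch, ← Finset.card_pair (show 0 ≠ u - s by omega)]
    congr 1
    ext v
    simp only [Finset.mem_filter, Finset.mem_range, Finset.mem_insert, Finset.mem_singleton]
    constructor
    · rintro ⟨-, hv⟩
      have hvu : v ≤ u - s := by obtain ⟨h, -⟩ := hv; omega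
      rcases Nat.eq_zero_or_pos v with h0 | h0
      · exact Or.inl h0
      · have := hmin _ (by omega) ((hmatch v hvu).1 hv)
        omega
    · rintro (rfl | rfl)
      · exact ⟨by omega, (hmatch 0 (by omega)).2 hs⟩
      · refine ⟨by omega, (hmatch _ le_rfl).2 ?_⟩
        rwa [Nat.add_sub_cancel' hsu.le]
  have := hτ.2 ⟨ρ, hcard⟩
  omega

/-- Inclusion–exclusion for the generating function of permutations without a `τ`-match. -/
lemma sum_NM_eq {R : Type*} [CommRing R] (τ : Equiv.Perm (Fin j))
    (w : Equiv.Perm (Fin n) → R) :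
    ∑ σ ∈ NM n τ, w σ = ∑ S ∈ (Finset.range n).powerset,
      (-1) ^ S.card * ∑ σ with ∀ s ∈ S, MatchAt τ σ s, w σ := by
  have hpt : ∀ σ : Equiv.Perm (Fin n), (if mch τ σ = 0 then w σ else 0) =
      ∑ S ∈ (Finset.range n).powerset,
        if ∀ s ∈ S, MatchAt τ σ s then (-1) ^ S.card * w σ else 0 := fun σ => by
    have h := congrArg (Int.cast : ℤ → R)
      (Finset.sum_powerset_neg_one_pow_card
        (x := (Finset.range n).filter fun i => MatchAt τ σ i))
    have hfilter : ((Finset.range n).filter fun i => MatchAt τ σ i).powerset =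
        (Finset.range n).powerset.filter fun S => ∀ s ∈ S, MatchAt τ σ s := by
      ext S
      simp only [Finset.mem_powerset, Finset.mem_filter, Finset.subset_iff]
      exact forall₂_and
    push_cast at h
    rw [hfilter] at h
    rw [← Finset.sum_filter, ← Finset.sum_mul, h, mch]
    simp only [Finset.card_eq_zero]
    split_ifs <;> simp
  rw [NM, Finset.sum_filter, Finset.sum_congr rfl fun σ _ => hpt σ, Finset.sum_comm]
  refine Finset.sum_congr rfl fun S _ => ?_
  rw [Finset.mul_sum, Finset.sum_filter]

/-- If replacing a single `α`-match by a `β`-match preserves `w`, then so does replacing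
all the matches at a set of positions pairwise at distance at least `j - 1`. -/
lemma sum_matchAt_eq {R : Type*} [AddCommMonoid R] {α β : Equiv.Perm (Fin j)}
    (hends : ∀ k : Fin j, (k : ℕ) = 0 ∨ (k : ℕ) = j - 1 → α k = β k)
    (w : Equiv.Perm (Fin n) → R)
    (hw : ∀ σ i, ∀ h : i + j ≤ n, MatchAt α σ i → w (σ * swapAt α β i h) = w σ)
    (S T : Finset ℕ) (hdisj : Disjoint S T)
    (hfar : ∀ s ∈ S ∪ T, ∀ t ∈ S ∪ T, s < t → s + (j - 1) ≤ t) :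
    (∑ σ with (∀ s ∈ S, MatchAt α σ s) ∧ ∀ t ∈ T, MatchAt β σ t, w σ) =
      ∑ σ with ∀ t ∈ S ∪ T, MatchAt β σ t, w σ := by
  induction S using Finset.induction_on generalizing T with
  | empty => simp
  | insert i S hi ih =>
    rw [Finset.disjoint_insert_left] at hdisj
    have hU : insert i S ∪ T = S ∪ insert i T := by
      rw [Finset.insert_union, Finset.union_insert]
    rw [hU] at hfar ⊢
    rw [← ih (insert i T) (Finset.disjoint_insert_right.2 ⟨hi, hdisj.2⟩) hfar]
    by_cases h : i + j ≤ n
    · have hi' : i ∈ S ∪ insert i T := by simp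
      have hother : ∀ s ∈ S ∪ insert i T, s ≠ i → ∀ (τ : Equiv.Perm (Fin j)) σ,
          MatchAt τ (σ * swapAt α β i h) s ↔ MatchAt τ σ s := fun s hs hsi τ σ => by
        refine matchAt_mul_swapAt_of_far hends τ σ h ?_
        rcases lt_or_gt_of_ne hsi with hlt | hlt
        · exact Or.inl (hfar s hs i hi' hlt)
        · exact Or.inr (hfar i hi' s hs hlt)
      refine Finset.sum_equiv (Equiv.mulRight (swapAt α β i h)) (fun σ => ?_) fun σ hσ => ?_
      · simp only [Finset.mem_filter, Finset.mem_univ, true_and, Finset.forall_mem_insert,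
          Equiv.coe_mulRight, matchAt_mul_swapAt]
        have hS : (∀ s ∈ S, MatchAt α (σ * swapAt α β i h) s) ↔ ∀ s ∈ S, MatchAt α σ s :=
          forall₂_congr fun s hs =>
            hother s (by simp [hs]) (fun hc => hi (hc ▸ hs)) α σ
        have hT : (∀ t ∈ T, MatchAt β (σ * swapAt α β i h) t) ↔ ∀ t ∈ T, MatchAt β σ t :=
          forall₂_congr fun t ht =>
            hother t (by simp [ht]) (fun hc => hdisj.1 (hc ▸ ht)) β σ
        rw [hS, hT]
        tauto
      · simp only [Finset.mem_filter, Finset.forall_mem_insert] at hσ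
        exact (hw σ i h hσ.2.1.1).symm
    · rw [Finset.filter_false_of_mem, Finset.filter_false_of_mem]
      · rintro σ - ⟨-, H⟩
        exact h (H i (Finset.mem_insert_self _ _)).1
      · rintro σ - ⟨H, -⟩
        exact h (H i (Finset.mem_insert_self _ _)).1

end

/-- Theorem: if `α, β ∈ S_j` (`j ≥ 3`) are mutually minimal overlapping, agree in
positions `1, …, a` (1-based) where `α_a = β_a = 1` and `1 ≤ a < j`, end with the same
element, `des α = des β` and `inv α = inv β`, then for all `n ≥ 0`,
`Σ_{σ∈NM_n(α)} x^{des σ} y^{LRmin σ} q^{inv σ}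
  = Σ_{σ∈NM_n(β)} x^{des σ} y^{LRmin σ} q^{inv σ}` as polynomials in `x` (= `X 0`),
`y` (= `X 1`) and `q` (= `X 2`), i.e. `α` and `β` are (des,inv,LRmin)-c-Wilf
equivalent. -/
theorem stmt10 {j : ℕ} (hj : 3 ≤ j) (α β : Equiv.Perm (Fin j))
    (hmm : MutuallyMinOverlapping α β)
    (a : ℕ) (ha1 : 1 ≤ a) (haj : a < j)
    (hpre : ∀ i : ℕ, ∀ hi : i < a, α ⟨i, by omega⟩ = β ⟨i, by omega⟩)
    (hαa : α ⟨a - 1, by omega⟩ = ⟨0, by omega⟩)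
    (hβa : β ⟨a - 1, by omega⟩ = ⟨0, by omega⟩)
    (hlast : α ⟨j - 1, by omega⟩ = β ⟨j - 1, by omega⟩)
    (hdes : des α = des β) (hinv : inv α = inv β) :
    ∀ n : ℕ,
      (∑ σ ∈ NM n α,
        (MvPolynomial.X 0 : MvPolynomial (Fin 3) ℚ) ^ des σ * MvPolynomial.X 1 ^ LRmin σ *
          MvPolynomial.X 2 ^ inv σ) =
      ∑ σ ∈ NM n β,
        (MvPolynomial.X 0 : MvPolynomial (Fin 3) ℚ) ^ des σ * MvPolynomial.X 1 ^ LRmin σ *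
          MvPolynomial.X 2 ^ inv σ := by
  intro n
  have hj0 : 0 < j := by omega
  have hagree : ∀ k : Fin j, k ≤ ⟨a - 1, by omega⟩ → α k = β k := fun k hk =>
    hpre k (by rw [Fin.le_def] at hk; simp only at hk; omega)
  have hmin : ∀ k, α ⟨a - 1, by omega⟩ ≤ α k := fun k => by
    rw [hαa]
    exact Nat.zero_le _
  have hends : ∀ k : Fin j, (k : ℕ) = 0 ∨ (k : ℕ) = j - 1 → α k = β k := by
    rintro ⟨k, hk⟩ (rfl | rfl)
    · exact hpre 0 ha1
    · exact hlast
  rw [sum_NM_eq, sum_NM_eq]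
  refine Finset.sum_congr rfl fun S _ => congrArg _ ?_
  by_cases hfar : ∀ s ∈ S, ∀ t ∈ S, s < t → s + (j - 1) ≤ t
  · have := sum_matchAt_eq hends (fun σ : Equiv.Perm (Fin n) =>
      (MvPolynomial.X 0 : MvPolynomial (Fin 3) ℚ) ^ des σ * MvPolynomial.X 1 ^ LRmin σ *
          MvPolynomial.X 2 ^ inv σ)
      (fun σ i h hm => by
        simp only [des_mul_swapAt hends hdes h hm,
          LRmin_mul_swapAt hagree hmin h hm, inv_mul_swapAt hinv h hm])
      S ∅ (Finset.disjoint_empty_right S) (by simpa using hfar)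
    simpa using this
  · push Not at hfar
    obtain ⟨s, hs, t, ht, hst, hlt⟩ := hfar
    have hempty : ∀ {τ : Equiv.Perm (Fin j)}, MinOverlapping τ →
        ∀ σ ∈ (Finset.univ : Finset (Equiv.Perm (Fin n))), ¬ ∀ s ∈ S, MatchAt τ σ s :=
      fun hτ σ _ H => hlt.not_ge (hτ.le_of_matchAt hj0 hst (H s hs) (H t ht))
    rw [Finset.filter_false_of_mem (hempty hmm.1), Finset.filter_false_of_mem (hempty hmm.2.1)]

end CWilf
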